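/- Every tiled local order O ⊂ M_n(D_p) is isomorphic (as an R_p-order, via conjugation by an element of M_n(D_p)^× = GL_n(D_p)) to an order in standard form, i.e. to some O(ñ, M) with ñ = (n_1,…,n_r) a partition of n and M = (m_ij) ∈ M_r(ℤ) satisfying m_ii = 0, m_ij + m_jk ≥ m_ik for all i, j, k, and m_ij + m_ji > 0 for all i ≠ j. -/

import Mathlib

open scoped ENNReal

namespace Paper

section Factorization

variable {M : Type*}

/-- `a` is an atom (irreducible element) of the monoid `M`. -/
def IsAtomM [Monoid M] (a : M) : Prop :=
  ¬ IsUnit a ∧ ∀ b c : M, a = b * c → IsUnit b ∨ IsUnit c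

/-- `a` has a factorization of length `k`: it is a unit times a product of `k` atoms. -/
def HasLen [Monoid M] (a : M) (k : ℕ) : Prop :=
  ∃ (ε : M) (u : Fin k → M), IsUnit ε ∧ (∀ i, IsAtomM (u i)) ∧
    a = ε * (List.ofFn u).prod

/-- The set of lengths `L(a)` of `a`. -/
def LenSet [Monoid M] (a : M) : Set ℕ := {k | HasLen a k}

/-- A monoid is atomic if every element admits a factorization into atoms. -/
def Atomic (M : Type*) [Monoid M] : Prop := ∀ a : M, ∃ k : ℕ, HasLen a k

/-- `sup L(a)`, valued in `ℝ≥0∞`. -/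
noncomputable def supLen [Monoid M] (a : M) : ℝ≥0∞ :=
  ⨆ k ∈ LenSet a, (k : ℝ≥0∞)

/-- `min L(a)`. -/
noncomputable def minLen [Monoid M] (a : M) : ℕ := sInf (LenSet a)

open Classical in
/-- The elasticity `ρ(a) = sup L(a) / min L(a)` of an element (`1` for units). -/
noncomputable def elastOf [Monoid M] (a : M) : ℝ≥0∞ :=
  if IsUnit a then 1 else supLen a / (minLen a : ℝ≥0∞)

/-- The elasticity `ρ(M) = sup {ρ(a) | a ∈ M}` of a monoid. -/
noncomputable def elasticity (M : Type*) [Monoid M] : ℝ≥0∞ :=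
  ⨆ a : M, elastOf a

/-- The refined elasticity `ρ_k(M) = sup {sup L(a) | min L(a) ≤ k}`. -/
noncomputable def refinedElasticity (M : Type*) [Monoid M] (k : ℕ) : ℝ≥0∞ :=
  ⨆ a : M, ⨆ (_ : minLen a ≤ k), supLen a

/-- The union `U_k(M)` of sets of lengths containing `k`. -/
def lengthUnion (M : Type*) [Monoid M] (k : ℕ) : Set ℕ :=
  {m | ∃ a : M, k ∈ LenSet a ∧ m ∈ LenSet a}

/-- Transfer homomorphism between monoids. -/
def IsTransferHom {M N : Type*} [Monoid M] [Monoid N] (φ : M →* N) : Prop :=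
  (∀ a : M, IsUnit (φ a) ↔ IsUnit a) ∧
  (∀ d : N, ∃ (u v : Nˣ) (a : M), d = ↑u * φ a * ↑v) ∧
  (∀ (a : M) (b₁ b₂ : N), φ a = b₁ * b₂ →
    ∃ (a₁ a₂ : M) (ε : Nˣ), a = a₁ * a₂ ∧ φ a₁ = b₁ * ↑ε ∧ φ a₂ = ↑ε⁻¹ * b₂)

/-- The restricted product `∏'_{i ∈ I} T_i` of a family of monoids: all but finitely
many components are units. -/
def restrictedProd {I : Type*} (T : I → Type*) [∀ i, Monoid (T i)] :
    Submonoid (∀ i, T i) where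
  carrier := {α | {i | ¬ IsUnit (α i)}.Finite}
  one_mem' := by
    have : {i | ¬ IsUnit ((1 : ∀ i, T i) i)} = ∅ := by
      ext i; simp
    simp only [Set.mem_setOf_eq, this]
    exact Set.finite_empty
  mul_mem' := by
    intro a b ha hb
    refine Set.Finite.subset (Set.Finite.union ha hb) ?_
    intro i hi
    by_contra h
    simp only [Set.mem_union, Set.mem_setOf_eq, not_or] at h  -- h : IsUnit (a i) ∧ IsUnit (b i)? no
    exact hi (IsUnit.mul (not_not.mp h.1) (not_not.mp h.2))

/-- A zero-sumfree sequence over a commutative monoid (written multiplicatively):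
no nonempty subsequence has product `1`. -/
def ZeroSumfree {G : Type*} [CommMonoid G] (s : Multiset G) : Prop :=
  ∀ t : Multiset G, t ≤ s → t ≠ 0 → t.prod ≠ 1

/-- The Davenport constant: `1 +` the maximal length of a zero-sumfree sequence. -/
noncomputable def davenport (G : Type*) [CommMonoid G] : ℕ :=
  1 + sSup {n : ℕ | ∃ s : Multiset G, ZeroSumfree s ∧ Multiset.card s = n}

/-- The `T`-block monoid `B_T(G, ι)` over `G` induced by `ι : T → G`: pairs `(S, α)`
of a sequence `S ∈ F(G)` and `α ∈ T` with `σ(S)·ι(α) = 1`. -/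
def blockMonoid {G T : Type*} [CommMonoid G] [Monoid T] (ι : T →* G) :
    Submonoid (Multiplicative (Multiset G) × T) where
  carrier := {x | (Multiplicative.toAdd x.1).prod * ι x.2 = 1}
  one_mem' := by simp
  mul_mem' := by
    intro a b ha hb
    simp only [Set.mem_setOf_eq, Prod.fst_mul, Prod.snd_mul, toAdd_mul, Multiset.prod_add,
      map_mul] at *
    rw [mul_mul_mul_comm, ha, hb, one_mul]

/-- Every right ideal is projective. -/
def IsHereditaryRing (R : Type*) [Ring R] : Prop :=
  ∀ I : Submodule Rᵐᵒᵖ R, Module.Projective Rᵐᵒᵖ I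

end Factorization

end Paper

namespace Paper

/-- The data of a central division algebra `D` over a non-archimedean local field `K_p`
(a completion of a number field at a finite place), together with its (normalized discrete)
valuations `v` on `K_p` and `w = v ∘ nrd` on `D`, a uniformizer `π` of `R_p`, a generator
`ϖ` of the maximal ideal of the unique maximal order `Δ_p = {x | w x ≥ 0}`, and the
reduced norms of the matrix algebras `M_ι(D)`, characterized via the reduced
characteristic polynomial. -/
structure LocalCSA where
  /-- the local field `K_p` -/
  Kp : Type
  [fieldKp : Field Kp]
  /-- the normalized discrete valuation on `K_p` -/
  v : Kp → ℤ
  v_mul : ∀ x y : Kp, x ≠ 0 → y ≠ 0 → v (x * y) = v x + v y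
  v_add : ∀ x y : Kp, x ≠ 0 → y ≠ 0 → x + y ≠ 0 → min (v x) (v y) ≤ v (x + y)
  v_neg : ∀ x : Kp, v (-x) = v x
  /-- a uniformizer of the valuation ring `R_p` -/
  piK : Kp
  piK_ne : piK ≠ 0
  v_piK : v piK = 1
  /-- `K_p` is complete with respect to `v` -/
  complete : ∀ f : ℕ → Kp,
    (∀ N : ℤ, ∃ M : ℕ, ∀ m n : ℕ, M ≤ m → M ≤ n → f m - f n = 0 ∨ N ≤ v (f m - f n)) →
    ∃ L : Kp, ∀ N : ℤ, ∃ M : ℕ, ∀ m : ℕ, M ≤ m → f m - L = 0 ∨ N ≤ v (f m - L)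
  /-- the central division algebra `D_p` -/
  D : Type
  [divD : DivisionRing D]
  [algD : Algebra Kp D]
  [fdD : FiniteDimensional Kp D]
  centralD : Subalgebra.center Kp D = ⊥
  /-- the degree `d` of `D_p`, so `dim_{K_p} D_p = d²` -/
  d : ℕ
  degD : Module.finrank Kp D = d * d
  /-- the valuation `w = v ∘ nrd` on `D_p` -/
  w : D → ℤ
  w_mul : ∀ x y : D, x ≠ 0 → y ≠ 0 → w (x * y) = w x + w y
  w_add : ∀ x y : D, x ≠ 0 → y ≠ 0 → x + y ≠ 0 → min (w x) (w y) ≤ w (x + y)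
  w_neg : ∀ x : D, w (-x) = w x
  w_algebraMap : ∀ x : Kp, x ≠ 0 → w (algebraMap Kp D x) = d * v x
  w_surj : ∀ k : ℤ, ∃ x : D, x ≠ 0 ∧ w x = k
  /-- a generator `ϖ` of the maximal ideal `𝔓` of `Δ_p` -/
  ϖ : D
  ϖ_ne : ϖ ≠ 0
  w_ϖ : w ϖ = 1
  /-- the reduced norm of the central simple algebra `M_ι(D_p)` over `K_p` -/
  nrd : ∀ {ι : Type} [Fintype ι] [DecidableEq ι], Matrix ι ι D → Kp
  nrd_mul : ∀ {ι : Type} [Fintype ι] [DecidableEq ι] (B C : Matrix ι ι D),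
    nrd (B * C) = nrd B * nrd C
  nrd_one : ∀ {ι : Type} [Fintype ι] [DecidableEq ι], nrd (1 : Matrix ι ι D) = 1
  nrd_charpoly : ∀ {ι : Type} [Fintype ι] [DecidableEq ι] (B : Matrix ι ι D),
    ∃ f : Polynomial Kp, f.Monic ∧ f.natDegree = Fintype.card ι * d ∧
      f ^ (Fintype.card ι * d) = LinearMap.charpoly (LinearMap.mulLeft Kp B) ∧
      nrd B = (-1) ^ (Fintype.card ι * d) * f.coeff 0
  /-- cancellative = nonzero reduced norm = invertible over `M_ι(D_p)` -/
  nrd_unit : ∀ {ι : Type} [Fintype ι] [DecidableEq ι] (B : Matrix ι ι D),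
    nrd B ≠ 0 ↔ IsUnit B
  /-- the reduced norm of a matrix with integral entries is integral -/
  nrd_int : ∀ {ι : Type} [Fintype ι] [DecidableEq ι] (B : Matrix ι ι D),
    (∀ i j, B i j = 0 ∨ 0 ≤ w (B i j)) → nrd B = 0 ∨ 0 ≤ v (nrd B)

attribute [instance] LocalCSA.fieldKp LocalCSA.divD LocalCSA.algD LocalCSA.fdD

namespace LocalCSA

variable (L : LocalCSA)

lemma w_one : L.w 1 = 0 := by
  have h := L.w_mul 1 1 one_ne_zero one_ne_zero
  rw [one_mul] at h
  omega

/-- The unique maximal order `Δ_p = {x ∈ D_p | w(x) ≥ 0}`. -/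
def Delta : Set L.D := {x | x = 0 ∨ 0 ≤ L.w x}

/-- The fractional-power `𝔓^m = {x ∈ D_p | w(x) ≥ m}` of the maximal ideal of `Δ_p`. -/
def Ppow (m : ℤ) : Set L.D := {x | x = 0 ∨ m ≤ L.w x}

lemma Ppow_zero_mem (m : ℤ) : (0 : L.D) ∈ L.Ppow m := Or.inl rfl

lemma Ppow_add_mem {m : ℤ} {x y : L.D} (hx : x ∈ L.Ppow m) (hy : y ∈ L.Ppow m) :
    x + y ∈ L.Ppow m := by
  by_cases hx0 : x = 0
  · subst hx0; simpa using hy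
  by_cases hy0 : y = 0
  · subst hy0; simpa using hx
  by_cases hxy : x + y = 0
  · exact Or.inl hxy
  have hwx : m ≤ L.w x := hx.resolve_left hx0
  have hwy : m ≤ L.w y := hy.resolve_left hy0
  exact Or.inr (le_trans (le_min hwx hwy) (L.w_add x y hx0 hy0 hxy))

lemma Ppow_mul_mem {s t : ℤ} {x y : L.D} (hx : x ∈ L.Ppow s) (hy : y ∈ L.Ppow t) :
    x * y ∈ L.Ppow (s + t) := by
  by_cases hx0 : x = 0
  · exact Or.inl (by simp [hx0])
  by_cases hy0 : y = 0
  · exact Or.inl (by simp [hy0])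
  have hwx : s ≤ L.w x := hx.resolve_left hx0
  have hwy : t ≤ L.w y := hy.resolve_left hy0
  exact Or.inr (by rw [L.w_mul x y hx0 hy0]; omega)

lemma Ppow_neg_mem {m : ℤ} {x : L.D} (hx : x ∈ L.Ppow m) : -x ∈ L.Ppow m := by
  rcases hx with rfl | hx
  · exact Or.inl (by simp)
  · exact Or.inr (by rw [L.w_neg]; exact hx)

lemma Ppow_mono {s t : ℤ} (h : s ≤ t) : L.Ppow t ⊆ L.Ppow s := by
  intro x hx
  rcases hx with rfl | hx
  · exact Or.inl rfl
  · exact Or.inr (le_trans h hx)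

lemma Ppow_one_mem {m : ℤ} (h : m ≤ 0) : (1 : L.D) ∈ L.Ppow m := by
  exact Or.inr (by rw [L.w_one]; exact h)

end LocalCSA

end Paper

namespace Paper

namespace LocalCSA

variable (L : LocalCSA)

/-- The exponent matrix conditions for a tiled order in standard form. -/
def IsStdForm {r : ℕ} (m : Fin r → Fin r → ℤ) : Prop :=
  (∀ i, m i i = 0) ∧ (∀ i j k, m i k ≤ m i j + m j k) ∧ (∀ i j, i ≠ j → 0 < m i j + m j i)

/-- The block index set of the partition `ñ = (n_1, …, n_r)` of `n`: an index in block
`i` is a pair `⟨i, x⟩` with `x ∈ Fin (n_i)`. -/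
abbrev BlockIdx {r : ℕ} (nv : Fin r → ℕ) : Type := (i : Fin r) × Fin (nv i)

/-- The underlying set of the order `O(ñ, M) = ⊕_{i,j} M_{n_i × n_j}(𝔓^{m_{ij}})`,
for matrices indexed by an index set `ι` with block-assignment `β : ι → Fin r`. -/
def stdSet {r : ℕ} (m : Fin r → Fin r → ℤ) {ι : Type} (β : ι → Fin r) :
    Set (Matrix ι ι L.D) :=
  {B | ∀ a b : ι, B a b ∈ L.Ppow (m (β a) (β b))}

/-- The order `O(ñ, M)` as a subring of the matrix algebra. -/
def stdOrder {r : ℕ} (m : Fin r → Fin r → ℤ) {ι : Type} [Fintype ι] [DecidableEq ι]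
    (β : ι → Fin r) (h0 : ∀ i, m i i = 0) (htri : ∀ i j k, m i k ≤ m i j + m j k) :
    Subring (Matrix ι ι L.D) where
  carrier := L.stdSet m β
  zero_mem' := fun a b => by simpa using L.Ppow_zero_mem _
  one_mem' := by
    intro a b
    by_cases h : a = b
    · subst h
      simpa [Matrix.one_apply_eq] using L.Ppow_one_mem (le_of_eq (h0 (β a)))
    · simpa [Matrix.one_apply_ne h] using L.Ppow_zero_mem _
  add_mem' := by
    intro B C hB hC a b
    simpa [Matrix.add_apply] using L.Ppow_add_mem (hB a b) (hC a b)
  neg_mem' := by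
    intro B hB a b
    simpa [Matrix.neg_apply] using L.Ppow_neg_mem (hB a b)
  mul_mem' := by
    intro B C hB hC a b
    rw [Matrix.mul_apply]
    refine Finset.sum_induction _ (· ∈ L.Ppow (m (β a) (β b)))
      (fun x y hx hy => L.Ppow_add_mem hx hy) (L.Ppow_zero_mem _) ?_
    intro c _
    exact L.Ppow_mono (htri (β a) (β c) (β b)) (L.Ppow_mul_mem (hB a c) (hC c b))

/-- The monoid `O^•` of cancellative elements (nonzero reduced norm) of a subring `O`
of a matrix algebra over `D_p`. -/
def matDot {ι : Type} [Fintype ι] [DecidableEq ι] (O : Subring (Matrix ι ι L.D)) :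
    Submonoid (Matrix ι ι L.D) where
  carrier := {B | B ∈ O ∧ L.nrd B ≠ 0}
  one_mem' := ⟨Subring.one_mem O, by rw [L.nrd_one]; exact one_ne_zero⟩
  mul_mem' := by
    intro B C hB hC
    exact ⟨Subring.mul_mem O hB.1 hC.1, by rw [L.nrd_mul]; exact mul_ne_zero hB.2 hC.2⟩

/-- `O` is an `R_p`-order in the algebra `B`: it contains the image of the valuation
ring `R_p = {x | v(x) ≥ 0}`, is finitely generated as an `R_p`-module, and spans `B`
over `K_p`. -/
def IsOrderIn {Kp : Type} [Field Kp] (v : Kp → ℤ) {B : Type} [Ring B] (ψ : Kp →+* B)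
    (O : Subring B) : Prop :=
  (∀ x : Kp, (x = 0 ∨ 0 ≤ v x) → ψ x ∈ O) ∧
  (∃ s : Finset B, ↑s ⊆ (O : Set B) ∧ ∀ b ∈ O, ∃ c : B → Kp,
      (∀ y : B, c y = 0 ∨ 0 ≤ v (c y)) ∧ b = ∑ y ∈ s, ψ (c y) * y) ∧
  (∀ b : B, ∃ x : Kp, x ≠ 0 ∧ ψ x * b ∈ O)

/-- A local order `O ⊆ M_n(D_p)` is tiled if it contains a conjugate of
`Diag(Δ_p, …, Δ_p)`. -/
def IsTiledOrder {n : ℕ} (O : Subring (Matrix (Fin n) (Fin n) L.D)) : Prop :=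
  IsOrderIn L.v (algebraMap L.Kp (Matrix (Fin n) (Fin n) L.D)) O ∧
  ∃ u : (Matrix (Fin n) (Fin n) L.D)ˣ,
    ∀ B : Matrix (Fin n) (Fin n) L.D,
      (∀ i j, (i = j → B i j ∈ L.Delta) ∧ (i ≠ j → B i j = 0)) →
      u.val * B * (u⁻¹).val ∈ O

end LocalCSA

end Paper

namespace Paper.LocalCSA

/-- A nonzero, bounded below left `Δ`-stable set is a power of `𝔓`. -/
lemma exists_Ppow (L : LocalCSA) (S : Set L.D) (hmul : ∀ a x, a ∈ L.Ppow 0 → x ∈ S → a * x ∈ S)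
    (hne : ∃ x ∈ S, x ≠ 0) (N : ℤ) (hN : ∀ x ∈ S, x ∈ L.Ppow N) :
    ∃ k : ℤ, ∀ x, x ∈ S ↔ x ∈ L.Ppow k := by
  obtain ⟨k, ⟨x₀, hx₀, hx₀0, rfl⟩, hk⟩ :=
    Int.exists_least_of_bdd (P := fun k => ∃ x ∈ S, x ≠ 0 ∧ L.w x = k)
    ⟨N, by rintro z ⟨x, hx, hx0, rfl⟩; exact (hN x hx).resolve_left hx0⟩
    (by obtain ⟨x, hx, hx0⟩ := hne; exact ⟨_, x, hx, hx0, rfl⟩)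
  refine ⟨L.w x₀, fun x => ⟨fun hx => ?_, fun hx => ?_⟩⟩
  · by_cases h : x = 0
    · exact Or.inl h
    · exact Or.inr (hk _ ⟨x, hx, h, rfl⟩)
  · have : x = (x * x₀⁻¹) * x₀ := by rw [mul_assoc, inv_mul_cancel₀ hx₀0, mul_one]
    rw [this]
    apply hmul _ _ _ hx₀
    rcases hx with rfl | hx
    · exact Or.inl (by simp)
    · by_cases h : x = 0
      · exact Or.inl (by simp [h])
      right
      have h1 := L.w_mul x₀ x₀⁻¹ hx₀0 (inv_ne_zero hx₀0)
      rw [mul_inv_cancel₀ hx₀0, L.w_one] at h1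
      rw [L.w_mul _ _ h (inv_ne_zero hx₀0)]
      omega

lemma w_inv (L : LocalCSA) {x : L.D} (hx : x ≠ 0) : L.w x⁻¹ = - L.w x := by
  have h1 := L.w_mul x x⁻¹ hx (inv_ne_zero hx)
  rw [mul_inv_cancel₀ hx, L.w_one] at h1
  omega

/-- Orders containing the diagonal ring are given by exponent matrices. -/
lemma exists_exponents (L : LocalCSA) {n : ℕ} (O : Subring (Matrix (Fin n) (Fin n) L.D))
    (hdiag : ∀ f : Fin n → L.D, (∀ i, f i ∈ L.Ppow 0) → Matrix.diagonal f ∈ O)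
    (hne : ∀ i j, ∃ x : L.D, x ≠ 0 ∧ Matrix.single i j x ∈ O)
    (N : ℤ) (hN : ∀ B ∈ O, ∀ i j, B i j ∈ L.Ppow N) :
    ∃ μ : Fin n → Fin n → ℤ, (∀ i, μ i i = 0) ∧ (∀ i j k, μ i k ≤ μ i j + μ j k) ∧
      ∀ B, B ∈ O ↔ ∀ i j, B i j ∈ L.Ppow (μ i j) := by
  have hs : ∀ i x, x ∈ L.Ppow 0 → Matrix.single i i x ∈ O := by
    intro i x hx
    rw [← Matrix.diagonal_single]
    apply hdiag
    intro j
    by_cases h : j = i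
    · subst h; simpa using hx
    · simpa [h] using L.Ppow_zero_mem 0
  have key : ∀ i j, ∃ k : ℤ, ∀ x : L.D, Matrix.single i j x ∈ O ↔ x ∈ L.Ppow k := by
    intro i j
    apply L.exists_Ppow {x | Matrix.single i j x ∈ O} _ _ N
    · intro x hx
      simpa using hN _ hx i j
    · intro a x ha hx
      simpa using O.mul_mem (hs i a ha) hx
    · obtain ⟨x, h1, h2⟩ := hne i j
      exact ⟨x, h2, h1⟩
  choose μ hμ using key
  have htri : ∀ i j k, μ i k ≤ μ i j + μ j k := by
    intro i j k
    obtain ⟨x, hx0, hx⟩ := L.w_surj (μ i j)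
    obtain ⟨y, hy0, hy⟩ := L.w_surj (μ j k)
    have h := O.mul_mem ((hμ i j x).2 (Or.inr hx.ge)) ((hμ j k y).2 (Or.inr hy.ge))
    rw [Matrix.single_mul_single_same, hμ] at h
    have := h.resolve_left (mul_ne_zero hx0 hy0)
    rw [L.w_mul _ _ hx0 hy0] at this
    omega
  refine ⟨μ, fun i => ?_, htri, fun B => ⟨fun hB i j => ?_, fun hB => ?_⟩⟩
  · have h1 := htri i i i
    have h2 := (hμ i i 1).1 (hs i 1 (L.Ppow_one_mem le_rfl))
    have h3 := h2.resolve_left one_ne_zero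
    rw [L.w_one] at h3
    omega
  · rw [← hμ]
    have h := O.mul_mem (O.mul_mem (hs i 1 (L.Ppow_one_mem le_rfl)) hB)
      (hs j 1 (L.Ppow_one_mem le_rfl))
    simpa using h
  · rw [Matrix.matrix_eq_sum_single B]
    exact O.sum_mem fun i _ => O.sum_mem fun j _ => (hμ i j _).2 (hB i j)

lemma Ppow_scale (L : LocalCSA) {s t x : L.D} (hs : s ≠ 0) (ht : t ≠ 0) (k : ℤ) :
    s⁻¹ * x * t ∈ L.Ppow (k - L.w s + L.w t) ↔ x ∈ L.Ppow k := by
  by_cases hx : x = 0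
  · subst hx; simp [Ppow_zero_mem]
  have hne : s⁻¹ * x * t ≠ 0 := mul_ne_zero (mul_ne_zero (inv_ne_zero hs) hx) ht
  have h : L.w (s⁻¹ * x * t) = L.w x - L.w s + L.w t := by
    rw [L.w_mul _ _ (mul_ne_zero (inv_ne_zero hs) hx) ht, L.w_mul _ _ (inv_ne_zero hs) hx,
      L.w_inv hs]
    ring
  simp only [Ppow, Set.mem_setOf_eq, hx, hne, h, false_or]
  constructor <;> intro _ <;> linarith

/-- Standard form of an exponent matrix after diagonal conjugation. -/
lemma exists_std (n : ℕ) (μ : Fin n → Fin n → ℤ) (h0 : ∀ i, μ i i = 0)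
    (htri : ∀ i j k, μ i k ≤ μ i j + μ j k) :
    ∃ (r : ℕ) (nv : Fin r → ℕ) (_ : ∀ i, 0 < nv i) (m : Fin r → Fin r → ℤ),
      IsStdForm m ∧ ∃ (e : BlockIdx nv ≃ Fin n) (κ : Fin n → ℤ),
        ∀ a b : BlockIdx nv, m a.1 b.1 = μ (e a) (e b) - κ (e a) + κ (e b) := by
  classical
  let st : Setoid (Fin n) :=
    { r := fun i j => μ i j + μ j i = 0
      iseqv := ⟨fun i => by simp [h0], fun {i j} h => by linarith, fun {i j k} h1 h2 => by
        have := htri i j k; have := htri k j i; have := htri i k i; have := h0 i; omega⟩ }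
  let E := Fintype.equivFin (Quotient st)
  let β : Fin n → Fin (Fintype.card (Quotient st)) := fun i => E (Quotient.mk st i)
  let ρ : Fin (Fintype.card (Quotient st)) → Fin n := fun c => (E.symm c).out
  have hβρ : ∀ c, β (ρ c) = c := by intro c; simp [β, ρ]
  have hρ : ∀ i, μ (ρ (β i)) i + μ i (ρ (β i)) = 0 := by
    intro i
    have : st.r (Quotient.mk st i).out i := Quotient.exact (Quotient.out_eq _)
    have h2 : ρ (β i) = (Quotient.mk st i).out := by simp [ρ, β]
    rw [h2]
    exact this
  let e : BlockIdx (fun c => Fintype.card {i // β i = c}) ≃ Fin n :=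
    (Equiv.sigmaCongrRight fun c => (Fintype.equivFin {i // β i = c}).symm).trans
      (Equiv.sigmaFiberEquiv β)
  have he : ∀ a, β (e a) = a.1 := by
    rintro ⟨c, x⟩
    exact ((Fintype.equivFin {i // β i = c}).symm x).2
  refine ⟨_, fun c => Fintype.card {i // β i = c}, ?_, fun c d => μ (ρ c) (ρ d),
    ⟨fun _ => h0 _, fun _ _ _ => htri _ _ _, ?_⟩, e, fun i => μ i (ρ (β i)), ?_⟩
  · intro c
    exact Fintype.card_pos_iff.2 ⟨⟨ρ c, hβρ c⟩⟩
  · intro c d hcd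
    have h1 := htri (ρ c) (ρ d) (ρ c)
    rw [h0] at h1
    refine lt_of_le_of_ne h1 fun h => hcd ?_
    rw [← hβρ c, ← hβρ d]
    exact congrArg E (Quotient.sound (s := st) h.symm)
  · intro a b
    have ha := hρ (e a)
    have hb := hρ (e b)
    rw [he] at ha hb
    simp only [he]
    have := htri (ρ a.1) (e a) (ρ b.1)
    have := htri (e a) (e b) (ρ b.1)
    have := htri (e a) (ρ a.1) (e b)
    have := htri (ρ a.1) (ρ b.1) (e b)
    omega

lemma d_nonneg_mem (L : LocalCSA) {x : L.Kp} (hx : x = 0 ∨ 0 ≤ L.v x) :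
    algebraMap L.Kp L.D x ∈ L.Ppow 0 := by
  rcases hx with rfl | hx
  · left; simp
  · by_cases h : x = 0
    · left; simp [h]
    · right; rw [L.w_algebraMap x h]; positivity

end Paper.LocalCSA

open Paper Paper.LocalCSA in
/-- Every tiled local order `O ⊆ M_n(D_p)` is isomorphic, via
conjugation by a unit of `M_n(D_p)` (and a relabelling of the index set by the block
index set of a partition `ñ = (n_1, …, n_r)` of `n`), to an order `O(ñ, M)` in standard
form: `m_ii = 0`, `m_ij + m_jk ≥ m_ik`, and `m_ij + m_ji > 0` for `i ≠ j`. -/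
theorem tiled_order_isomorphic_standard_form (L : LocalCSA) (n : ℕ)
    (O : Subring (Matrix (Fin n) (Fin n) L.D)) (hO : L.IsTiledOrder O) :
    ∃ (r : ℕ) (nv : Fin r → ℕ) (_ : ∀ i, 0 < nv i) (m : Fin r → Fin r → ℤ),
      IsStdForm m ∧
      ∃ (e : BlockIdx nv ≃ Fin n) (u : (Matrix (Fin n) (Fin n) L.D)ˣ),
        ∀ B : Matrix (Fin n) (Fin n) L.D,
          B ∈ O ↔ (Matrix.reindex e.symm e.symm ((u⁻¹).val * B * u.val)
            ∈ L.stdSet m (Sigma.fst : BlockIdx nv → Fin r)) := by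
  classical
  obtain ⟨⟨-, ⟨s, -, hgen⟩, hspan⟩, u, hu⟩ := hO
  -- the conjugated order
  let φ : Matrix (Fin n) (Fin n) L.D →+* Matrix (Fin n) (Fin n) L.D :=
    { toFun := fun B => u.val * B * (u⁻¹).val
      map_one' := by simp
      map_zero' := by simp
      map_add' := fun x y => by rw [mul_add, add_mul]
      map_mul' := fun x y => by simp [mul_assoc] }
  have hφ : ∀ B, φ B = u.val * B * (u⁻¹).val := fun _ => rfl
  have hfin : ∃ N : ℤ, ∀ y ∈ s, ∀ i j, ((u⁻¹).val * y * u.val) i j ∈ L.Ppow N := by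
    obtain ⟨N, hN⟩ := ((s ×ˢ (Finset.univ : Finset (Fin n × Fin n))).image
      (fun p => L.w (((u⁻¹).val * p.1 * u.val) p.2.1 p.2.2))).bddBelow
    refine ⟨N, fun y hy i j => Or.inr (hN ?_)⟩
    simp only [Finset.coe_image, Set.mem_image]
    exact ⟨(y, i, j), by simpa using hy, rfl⟩
  obtain ⟨N, hN⟩ := hfin
  obtain ⟨μ, h0, htri, hμ⟩ := L.exists_exponents (O.comap φ) (by
      intro f hf
      refine hu _ fun i j => ⟨fun h => ?_, fun h => ?_⟩
      · subst h; rw [Matrix.diagonal_apply_eq]; exact hf i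
      · simp [h]) (by
      intro i j
      obtain ⟨x, hx, hxO⟩ := hspan (φ (Matrix.single i j 1))
      refine ⟨algebraMap L.Kp L.D x, by simpa using hx, ?_⟩
      rw [Subring.mem_comap]
      convert hxO using 1
      have : Matrix.single i j (algebraMap L.Kp L.D x) = algebraMap L.Kp (Matrix (Fin n) (Fin n) L.D) x *
          Matrix.single i j 1 := by
        rw [← Algebra.smul_def, Matrix.smul_single, Algebra.algebraMap_eq_smul_one]
      rw [this, hφ, hφ, ← mul_assoc, ← Algebra.commutes x u.val]
      simp only [mul_assoc]) N (by
      intro B hB i j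
      obtain ⟨c, hc, hb⟩ := hgen _ hB
      have hB' : B = ∑ y ∈ s, algebraMap L.Kp (Matrix (Fin n) (Fin n) L.D) (c y) *
          ((u⁻¹).val * y * u.val) := by
        have : B = (u⁻¹).val * φ B * u.val := by simp [hφ, mul_assoc]
        rw [this, hb, Finset.mul_sum, Finset.sum_mul]
        refine Finset.sum_congr rfl fun y _ => ?_
        rw [← mul_assoc, ← Algebra.commutes (c y) (u⁻¹).val]
        simp only [mul_assoc]
      rw [hB', Matrix.sum_apply]
      refine Finset.sum_induction _ (· ∈ L.Ppow N)
        (fun x y hx hy => L.Ppow_add_mem hx hy) (L.Ppow_zero_mem _) ?_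
      intro y hy
      rw [← Algebra.smul_def, Matrix.smul_apply, Algebra.smul_def]
      simpa using L.Ppow_mul_mem (L.d_nonneg_mem (hc y)) (hN y hy i j))
  obtain ⟨r, nv, hnv, m, hm, e, κ, hκ⟩ := exists_std n μ h0 htri
  choose t ht0 ht using fun i => L.w_surj (κ i)
  let T : (Matrix (Fin n) (Fin n) L.D)ˣ :=
    ⟨Matrix.diagonal t, Matrix.diagonal fun i => (t i)⁻¹,
      by simp [Matrix.diagonal_mul_diagonal, ht0],
      by simp [Matrix.diagonal_mul_diagonal, ht0]⟩
  refine ⟨r, nv, hnv, m, hm, e, u * T, fun B => ?_⟩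
  have h1 : B ∈ O ↔ (u⁻¹).val * B * u.val ∈ O.comap φ := by
    rw [Subring.mem_comap, hφ]; simp [mul_assoc]
  have h2 : ((u * T)⁻¹).val * B * (u * T).val =
      Matrix.diagonal (fun i => (t i)⁻¹) * ((u⁻¹).val * B * u.val) * Matrix.diagonal t := by
    rw [mul_inv_rev, Units.val_mul, Units.val_mul]
    simp only [mul_assoc]
    rfl
  rw [h1, hμ, h2]
  generalize (u⁻¹).val * B * u.val = C
  constructor
  · intro h a b
    rw [hκ, Matrix.reindex_apply, Matrix.submatrix_apply]
    simp only [Equiv.symm_symm, Matrix.mul_diagonal, Matrix.diagonal_mul]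
    rw [← ht (e a), ← ht (e b), L.Ppow_scale (ht0 _) (ht0 _)]
    exact h _ _
  · intro h i j
    have := h (e.symm i) (e.symm j)
    rw [hκ, Matrix.reindex_apply, Matrix.submatrix_apply] at this
    simp only [Equiv.symm_symm, Matrix.mul_diagonal, Matrix.diagonal_mul,
      Equiv.apply_symm_apply] at this
    rwa [← ht i, ← ht j, L.Ppow_scale (ht0 _) (ht0 _)] at this
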